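/- Let R be a Lie conformal algebra over ℂ and define, for a, b ∈ R, the bracket [a,b] = ∑_{n≥0} (−1)^n (1/(n+1)!) ∂^{n+1}(a_(n)b) (a finite sum by truncation; this is the bracket making R into the Lie algebra R_Lie). If a ∈ R^j and b ∈ R^{j'} for some j, j' ≥ 1, then [a,b] ∈ R^{j+j'}. -/

import Mathlib

noncomputable section

/-- A Lie conformal algebra over `ℂ`: a vector space `R` with a linear map `∂` and
bilinear `n`-th products (`n : ℕ`) satisfying truncation, sesquilinearity,
skew-symmetry and the Jacobi identity.  (Here `mul (n-1)` with `n = 0` is `mul 0`,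
but its coefficient vanishes, so the convention `a_(−1)b = 0` is respected.) -/
structure LieConformalAlgebra (R : Type*) [AddCommGroup R] [Module ℂ R] where
  /-- the translation operator `∂` -/
  D : R →ₗ[ℂ] R
  /-- the `n`-th product `a b ↦ a_(n) b`, bilinear for every `n : ℕ` -/
  mul : ℕ → R →ₗ[ℂ] R →ₗ[ℂ] R
  truncation : ∀ a b : R, ∃ N : ℕ, ∀ n ≥ N, mul n a b = 0
  sesq_left : ∀ (n : ℕ) (a b : R), mul n (D a) b = (-(n : ℂ)) • mul (n - 1) a b
  sesq_right : ∀ (n : ℕ) (a b : R),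
    mul n a (D b) = D (mul n a b) + (n : ℂ) • mul (n - 1) a b
  skew : ∀ (n : ℕ) (a b : R),
    mul n b a =
      ∑ᶠ j : ℕ, ((-1 : ℂ) ^ (n + j + 1) * ((j.factorial : ℂ))⁻¹) •
        (D ^ j) (mul (n + j) a b)
  jacobi : ∀ (m n : ℕ) (a b c : R),
    mul m a (mul n b c) =
      (∑ j ∈ Finset.range (m + 1), (m.choose j : ℂ) • mul (m + n - j) (mul j a b) c)
        + mul n b (mul m a c)

variable {R : Type*} [AddCommGroup R] [Module ℂ R]

/-- An ideal of a Lie conformal algebra: a linear subspace `I` with `∂I ⊆ I` and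
`a_(n) i ∈ I` for all `a ∈ R`, `i ∈ I`, `n ∈ ℕ`. -/
def LieConformalAlgebra.IsIdeal (L : LieConformalAlgebra R) (I : Submodule ℂ R) : Prop :=
  (∀ x ∈ I, L.D x ∈ I) ∧ ∀ (a : R), ∀ x ∈ I, ∀ n : ℕ, L.mul n a x ∈ I

/-- The bracket `[I·J]` of two subspaces: the linear span of all products `i_(n) j`
with `i ∈ I`, `j ∈ J`, `n ∈ ℕ`. -/
def LieConformalAlgebra.bracket (L : LieConformalAlgebra R) (I J : Submodule ℂ R) :
    Submodule ℂ R :=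
  Submodule.span ℂ {x : R | ∃ i ∈ I, ∃ j ∈ J, ∃ n : ℕ, x = L.mul n i j}


/-- The lower central series of a Lie conformal algebra, indexed so that
`lcs L j = R^{j+1}`: `lcs L 0 = R¹ = R` and `lcs L (j+1) = [R · lcs L j]`. -/
def LieConformalAlgebra.lcs (L : LieConformalAlgebra R) : ℕ → Submodule ℂ R
  | 0 => ⊤
  | j + 1 => L.bracket ⊤ (L.lcs j)

/-- The Lie bracket `[a,b] = ∑_{n≥0} (−1)ⁿ (1/(n+1)!) ∂^{n+1}(a_(n) b)` making `R`
into the Lie algebra `R_Lie` (a finite sum by truncation). -/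
def LieConformalAlgebra.lieBr (L : LieConformalAlgebra R) (a b : R) : R :=
  ∑ᶠ n : ℕ, ((-1 : ℂ) ^ n * (((n + 1).factorial : ℂ))⁻¹) •
    (L.D ^ (n + 1)) (L.mul n a b)

namespace LieConformalAlgebra

theorem mul_mem_lcs_succ (L : LieConformalAlgebra R) {j : ℕ} (a : R) {b : R}
    (hb : b ∈ L.lcs j) (n : ℕ) : L.mul n a b ∈ L.lcs (j + 1) :=
  Submodule.subset_span ⟨a, Submodule.mem_top, b, hb, n, rfl⟩

theorem D_mem_lcs (L : LieConformalAlgebra R) {j : ℕ} {x : R} (hx : x ∈ L.lcs j) :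
    L.D x ∈ L.lcs j := by
  induction j generalizing x with
  | zero => exact Submodule.mem_top
  | succ j ih =>
    refine (Submodule.span_le (p := (L.lcs (j + 1)).comap L.D)).2 ?_ hx
    rintro _ ⟨a, -, b, hb, n, rfl⟩
    have h : L.D (L.mul n a b) = L.mul n a (L.D b) - (n : ℂ) • L.mul (n - 1) a b := by
      rw [L.sesq_right, add_sub_cancel_right]
    rw [SetLike.mem_coe, Submodule.mem_comap, h]
    exact sub_mem (L.mul_mem_lcs_succ a (ih hb) n)
      (Submodule.smul_mem _ _ (L.mul_mem_lcs_succ a hb (n - 1)))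

theorem D_pow_mem_lcs (L : LieConformalAlgebra R) {j : ℕ} {x : R} (hx : x ∈ L.lcs j)
    (k : ℕ) : (L.D ^ k) x ∈ L.lcs j := by
  induction k with
  | zero => simpa using hx
  | succ k ih =>
    rw [pow_succ', Module.End.mul_apply]
    exact L.D_mem_lcs ih

/-- The lower central series satisfies `[R^i · R^j] ⊆ R^{i+j}`. -/
theorem mul_mem_lcs (L : LieConformalAlgebra R) {j j' : ℕ} {a b : R}
    (ha : a ∈ L.lcs j) (hb : b ∈ L.lcs j') (n : ℕ) :
    L.mul n a b ∈ L.lcs (j + j' + 1) := by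
  induction j generalizing j' a b n with
  | zero => simpa using L.mul_mem_lcs_succ a hb n
  | succ j ih =>
    refine (Submodule.span_le
      (p := (L.lcs (j + 1 + j' + 1)).comap ((L.mul n).flip b))).2 ?_ ha
    rintro _ ⟨x, -, c, hc, m, rfl⟩
    rw [SetLike.mem_coe, Submodule.mem_comap, LinearMap.flip_apply]
    induction m using Nat.strong_induction_on generalizing n with
    | _ m ihm =>
      have hJ := L.jacobi m n x c b
      rw [Finset.sum_range_succ, Nat.choose_self, Nat.cast_one, one_smul,
        Nat.add_sub_cancel_left] at hJ
      have h : L.mul n (L.mul m x c) b = L.mul m x (L.mul n c b) - L.mul n c (L.mul m x b)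
          - ∑ i ∈ Finset.range m,
            (m.choose i : ℂ) • L.mul (m + n - i) (L.mul i x c) b := by
        rw [hJ]; abel
      rw [h]
      refine sub_mem (sub_mem ?_ ?_) (Submodule.sum_mem _ fun i hi =>
        Submodule.smul_mem _ _ (ihm i (Finset.mem_range.1 hi) _))
      · rw [show j + 1 + j' + 1 = j + j' + 1 + 1 by omega]
        exact L.mul_mem_lcs_succ x (ih hc hb n) m
      · rw [show j + 1 + j' + 1 = j + (j' + 1) + 1 by omega]
        exact ih hc (L.mul_mem_lcs_succ x hb m) n

end LieConformalAlgebra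

/-- If `a ∈ R^j` and `b ∈ R^{j'}` (terms of the lower central
series, `j, j' ≥ 1`), then `[a,b] ∈ R^{j+j'}`.  (Here `lcs L j = R^{j+1}`.) -/
theorem lieBr_mem_lcs (L : LieConformalAlgebra R) (j j' : ℕ) (a b : R)
    (ha : a ∈ L.lcs j) (hb : b ∈ L.lcs j') : L.lieBr a b ∈ L.lcs (j + j' + 1) := by
  exact finsum_induction (· ∈ L.lcs (j + j' + 1)) (zero_mem _) (fun _ _ => add_mem)
    fun n => Submodule.smul_mem _ _ (L.D_pow_mem_lcs (L.mul_mem_lcs ha hb n) (n + 1))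

end
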